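/- Well-posedness of the semi-implicit parametric finite element scheme (Theorem 3.1, linear-algebraic form). Let X and M be finite-dimensional real vector spaces, let τ > 0, let a : M × M → ℝ be a symmetric positive semidefinite bilinear form, let b : X × X → ℝ be a symmetric positive definite bilinear form, and let c : X × M → ℝ be a bilinear form such that the only μ ∈ M with a(μ, μ) = 0 and c(x, μ) = 0 for all x ∈ X is μ = 0. Then for every pair of linear functionals F : M → ℝ and G : X → ℝ there exists exactly one pair (x, μ) ∈ X × M such that c(x, φ) + τ a(μ, φ) = F(φ) for all φ ∈ M and c(ω, μ) − b(x, ω) = G(ω) for all ω ∈ X. -/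

import Mathlib

/-- **Well-posedness of the semi-implicit PFEM scheme** (Theorem 3.1,
linear-algebraic form).  Let `X` and `M` be finite-dimensional real vector
spaces, `τ > 0`, `a` a symmetric positive semidefinite bilinear form on `M`,
`b` a symmetric positive definite bilinear form on `X`, and `c : X × M → ℝ`
a bilinear form such that the only `μ` with `a μ μ = 0` and `c x μ = 0` for
all `x` is `μ = 0`.  Then for all linear functionals `F : M → ℝ`,
`G : X → ℝ` there is exactly one pair `(x, μ)` with
`c x φ + τ * a μ φ = F φ` for all `φ` and `c ω μ - b x ω = G ω` for all `ω`. -/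
theorem pfem_well_posed
    (X M : Type*) [AddCommGroup X] [Module ℝ X] [FiniteDimensional ℝ X]
    [AddCommGroup M] [Module ℝ M] [FiniteDimensional ℝ M]
    (τ : ℝ) (hτ : 0 < τ)
    (a : M →ₗ[ℝ] M →ₗ[ℝ] ℝ)
    (ha_symm : ∀ μ ν : M, a μ ν = a ν μ)
    (ha_psd : ∀ μ : M, 0 ≤ a μ μ)
    (b : X →ₗ[ℝ] X →ₗ[ℝ] ℝ)
    (hb_symm : ∀ x y : X, b x y = b y x)
    (hb_pd : ∀ x : X, x ≠ 0 → 0 < b x x)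
    (c : X →ₗ[ℝ] M →ₗ[ℝ] ℝ)
    (hc : ∀ μ : M, a μ μ = 0 → (∀ x : X, c x μ = 0) → μ = 0)
    (F : M →ₗ[ℝ] ℝ) (G : X →ₗ[ℝ] ℝ) :
    ∃! p : X × M,
      (∀ φ : M, c p.1 φ + τ * a p.2 φ = F φ) ∧
      (∀ ω : X, c ω p.2 - b p.1 ω = G ω) := by
  let T : X × M →ₗ[ℝ] Module.Dual ℝ M × Module.Dual ℝ X :=
    (c.coprod (τ • a)).prod ((-b).coprod c.flip)
  have hT₁ (p : X × M) (φ : M) : (T p).1 φ = c p.1 φ + τ * a p.2 φ := by simp [T]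
  have hT₂ (p : X × M) (ω : X) : (T p).2 ω = c ω p.2 - b p.1 ω := by simp [T]; ring
  have hT_inj : Function.Injective T := by
    rw [injective_iff_map_eq_zero]
    rintro ⟨x, μ⟩ hp
    have h₁ (φ : M) : c x φ + τ * a μ φ = 0 := by
      rw [← hT₁ (x, μ) φ, hp]; rfl
    have h₂ (ω : X) : c ω μ - b x ω = 0 := by
      rw [← hT₂ (x, μ) ω, hp]; rfl
    have hτa : 0 ≤ τ * a μ μ := mul_nonneg hτ.le (ha_psd μ)
    have hx : x = 0 := by
      by_contra hx
      linarith [h₁ μ, h₂ x, hb_pd x hx]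
    subst hx
    have haμ : a μ μ = 0 := by simpa [hτ.ne'] using h₁ μ
    have hμ : μ = 0 := hc μ haμ fun ω => by simpa using h₂ ω
    simp [hμ]
  have hT_surj : Function.Surjective T := by
    refine (LinearMap.injective_iff_surjective_of_finrank_eq_finrank ?_).1 hT_inj
    simp only [Module.finrank_prod, Subspace.dual_finrank_eq, add_comm]
  obtain ⟨p, hp, hp_unique⟩ := Function.Bijective.existsUnique ⟨hT_inj, hT_surj⟩ (F, G)
  refine ⟨p, ⟨fun φ => ?_, fun ω => ?_⟩, fun q hq => hp_unique q ?_⟩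
  · rw [← hT₁, hp]
  · rw [← hT₂, hp]
  · exact Prod.ext (LinearMap.ext fun φ => (hT₁ q φ).trans (hq.1 φ))
      (LinearMap.ext fun ω => (hT₂ q ω).trans (hq.2 ω))
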